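/- arXiv:1507.06038 — 3 statements merged into one kernel-verified Lean document; each statement's English description precedes it below -/
import Mathlib

section
/- Let η(x) = −x log₂ x for x > 0, with η(0) = 0. Then for all r, s ∈ [0,1] with |r − s| ≤ 1/2, it holds that |η(r) − η(s)| ≤ η(|r − s|). -/
/-- The function `η(x) = -x log₂ x` (with `η(0) = 0`, which holds since `Real.logb 2 0 = 0`). -/
noncomputable def binEta (x : ℝ) : ℝ := -x * Real.logb 2 x

open Real in
theorem binEta_eq_negMulLog_div (x : ℝ) : binEta x = negMulLog x / log 2 := by
  rw [binEta, negMulLog, logb, mul_div_assoc]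

/-- The increments of a concave function over intervals of fixed length are antitone. -/
theorem ConcaveOn.add_sub_le_add_sub {S : Set ℝ} {f : ℝ → ℝ} (hf : ConcaveOn ℝ S f) {a b t : ℝ}
    (ha : a ∈ S) (hbt : b + t ∈ S) (hab : a ≤ b) (ht : 0 ≤ t) :
    f (b + t) - f b ≤ f (a + t) - f a := by
  rcases ht.eq_or_lt with rfl | ht
  · simp
  have hd : 0 < b - a + t := by linarith
  have hw : 0 ≤ t / (b - a + t) := by positivity
  have hv : 0 ≤ (b - a) / (b - a + t) := div_nonneg (by linarith) hd.le
  have hsum : t / (b - a + t) + (b - a) / (b - a + t) = 1 := by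
    field_simp
    ring
  have h₁ := hf.2 ha hbt hw hv hsum
  have h₂ := hf.2 ha hbt hv hw (by rw [add_comm, hsum])
  have e₁ : t / (b - a + t) * a + (b - a) / (b - a + t) * (b + t) = b := by
    field_simp
    ring
  have e₂ : (b - a) / (b - a + t) * a + t / (b - a + t) * (b + t) = a + t := by
    field_simp
    ring
  simp only [smul_eq_mul, e₁, e₂] at h₁ h₂
  linear_combination h₁ + h₂ - (f a + f (b + t)) * hsum

namespace Real

theorem concaveOn_negMulLog_sub_negMulLog_one_sub :
    ConcaveOn ℝ (Set.Icc 0 (1 / 2)) fun t ↦ negMulLog t - negMulLog (1 - t) := by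
  have hderiv : ∀ t ∈ Set.Ioo (0 : ℝ) (1 / 2),
      HasDerivAt (fun t ↦ negMulLog t - negMulLog (1 - t)) (-log (t * (1 - t)) - 2) t := by
    rintro t ⟨h₀, h₁⟩
    have h₂ : 1 - t ≠ 0 := by linarith
    refine ((hasDerivAt_negMulLog h₀.ne').sub
      ((hasDerivAt_negMulLog h₂).comp t ((hasDerivAt_id t).const_sub 1))).congr_deriv ?_
    rw [log_mul h₀.ne' h₂]
    ring
  refine AntitoneOn.concaveOn_of_deriv (convex_Icc _ _) (by fun_prop) ?_ ?_ <;>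
    rw [interior_Icc]
  · exact fun t ht ↦ (hderiv t ht).differentiableAt.differentiableWithinAt
  · intro x hx y hy hxy
    rw [(hderiv x hx).deriv, (hderiv y hy).deriv]
    have hpos : 0 < x * (1 - x) := mul_pos hx.1 (by linarith [hx.2])
    have hle : x * (1 - x) ≤ y * (1 - y) := by nlinarith [hx.2, hy.2]
    linarith [log_le_log hpos hle]

theorem negMulLog_one_sub_le_negMulLog {t : ℝ} (h₀ : 0 ≤ t) (h₁ : t ≤ 1 / 2) :
    negMulLog (1 - t) ≤ negMulLog t := by
  have h := concaveOn_negMulLog_sub_negMulLog_one_sub.min_le_of_mem_Icc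
    (Set.left_mem_Icc.2 (by norm_num)) (Set.right_mem_Icc.2 (by norm_num)) ⟨h₀, h₁⟩
  norm_num at h
  exact h

theorem abs_negMulLog_sub_negMulLog_le_of_le {r s : ℝ} (hs : 0 ≤ s) (hsr : s ≤ r) (hr : r ≤ 1)
    (h : r - s ≤ 1 / 2) : |negMulLog r - negMulLog s| ≤ negMulLog (r - s) := by
  have ht : 0 ≤ r - s := sub_nonneg.2 hsr
  have h₁ := concaveOn_negMulLog.add_sub_le_add_sub (a := 0) (b := s) (t := r - s)
    (by simp) (by simp only [Set.mem_Ici]; linarith) hs ht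
  have h₂ := concaveOn_negMulLog.add_sub_le_add_sub (a := s) (b := 1 - (r - s)) (t := r - s)
    hs (by simp) (by linarith) ht
  have h₃ := negMulLog_one_sub_le_negMulLog ht h
  simp only [add_sub_cancel, zero_add, sub_add_cancel, negMulLog_zero, negMulLog_one] at h₁ h₂
  rw [abs_le]
  constructor <;> linarith

end Real

/-- For `r, s ∈ [0,1]` with `|r - s| ≤ 1/2`, one has `|η(r) - η(s)| ≤ η(|r - s|)`. -/
theorem abs_eta_sub_eta_le (r s : ℝ) (hr : r ∈ Set.Icc (0 : ℝ) 1)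
    (hs : s ∈ Set.Icc (0 : ℝ) 1) (hrs : |r - s| ≤ 1 / 2) :
    |binEta r - binEta s| ≤ binEta |r - s| := by
  have hlog : 0 < Real.log 2 := Real.log_pos one_lt_two
  simp only [binEta_eq_negMulLog_div]
  rw [← sub_div, abs_div, abs_of_pos hlog]
  gcongr
  rcases le_total s r with h | h
  · rw [abs_of_nonneg (sub_nonneg.2 h)] at hrs ⊢
    exact Real.abs_negMulLog_sub_negMulLog_le_of_le hs.1 h hr.2 hrs
  · rw [abs_sub_comm r s, abs_of_nonneg (sub_nonneg.2 h)] at hrs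
    rw [abs_sub_comm r s, abs_of_nonneg (sub_nonneg.2 h), abs_sub_comm]
    exact Real.abs_negMulLog_sub_negMulLog_le_of_le hr.1 h hs.2 hrs
end

section
/- Let μ be the Haar probability measure on the group U(d) of d×d complex unitary matrices, let ψ ∈ ℂ^d be a unit vector, and let ρ = ψψ† be the associated rank-one projection. Then ∫ (U ρ U†) ⊗ (U ρ U†) dμ(U) = (2/(d(d+1))) · P_sym, where the tensor product is the Kronecker product of matrices and P_sym = (1/2)(I + S) is the projector onto the symmetric subspace of ℂ^d ⊗ ℂ^d, with S the swap matrix having entries S_{(i,j),(k,l)} = δ_{i,l} δ_{j,k}. -/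
open MeasureTheory
open Kronecker

noncomputable instance matrixMeasurableSpace (d : ℕ) :
    MeasurableSpace (Matrix (Fin d) (Fin d) ℂ) := borel _

/-- The swap matrix `S` on `ℂ^d ⊗ ℂ^d`, with entries `S_{(i,j),(k,l)} = δ_{i,l} δ_{j,k}`. -/
def swapMatrix (d : ℕ) : Matrix (Fin d × Fin d) (Fin d × Fin d) ℂ :=
  fun p q => if p.1 = q.2 ∧ p.2 = q.1 then 1 else 0

/-- The projector `P_sym = (I + S)/2` onto the symmetric subspace of `ℂ^d ⊗ ℂ^d`. -/
noncomputable def symProj (d : ℕ) : Matrix (Fin d × Fin d) (Fin d × Fin d) ℂ :=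
  (1 / 2 : ℂ) • ((1 : Matrix (Fin d × Fin d) (Fin d × Fin d) ℂ) + swapMatrix d)

namespace Matrix

variable {n : Type*} [Fintype n] [DecidableEq n]

/-- A rank-one perturbation `1 + c w w†` of the identity is unitary
when `c + c̄ + |c|² ‖w‖² = 0`. -/
theorem one_add_smul_vecMulVec_mem_unitaryGroup {c : ℂ} {w : n → ℂ}
    (h : c + star c + c * star c * (star w ⬝ᵥ w) = 0) :
    1 + c • vecMulVec w (star w) ∈ unitaryGroup n ℂ := by
  rw [mem_unitaryGroup_iff, star_eq_conjTranspose]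
  have hmul : vecMulVec w (star w) * vecMulVec w (star w)
      = (star w ⬝ᵥ w) • vecMulVec w (star w) := by
    ext i j
    simp [vecMulVec_mul_vecMulVec, vecMulVec_apply]
    ring
  have hstar : (vecMulVec w (star w))ᴴ = vecMulVec w (star w) := by
    rw [conjTranspose_vecMulVec, star_star]
  rw [conjTranspose_add, conjTranspose_one, conjTranspose_smul, hstar, add_mul, mul_add,
    mul_add, one_mul, one_mul, mul_one, smul_mul_smul_comm, hmul, smul_smul, add_assoc, ← add_smul,
    ← add_smul]
  rw [show star c + (c + c * star c * (star w ⬝ᵥ w)) = 0 by rw [← h]; ring]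
  simp

theorem exists_unitaryGroup_mulVec_eq {c : ℂ} {w : n → ℂ}
    (h : c + star c + c * star c * (star w ⬝ᵥ w) = 0) :
    ∃ V : unitaryGroup n ℂ, ∀ x, V.1 *ᵥ x = x + (c * (star w ⬝ᵥ x)) • w := by
  refine ⟨⟨_, one_add_smul_vecMulVec_mem_unitaryGroup h⟩, fun x => ?_⟩
  rw [add_mulVec, one_mulVec, smul_mulVec, vecMulVec_mulVec]
  ext i
  simp
  ring

end Matrix

section HaarMoments

variable {d : ℕ} (μ : Measure (Matrix.unitaryGroup (Fin d) ℂ)) (ψ : Fin d → ℂ)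

/-- The fourth moment `∫ xᵢ xⱼ x̄ₖ x̄ₗ` of the random vector `x = Uψ`. -/
noncomputable def haarMoment (i j k l : Fin d) : ℂ :=
  ∫ U : Matrix.unitaryGroup (Fin d) ℂ,
    (U.1.mulVec ψ i * U.1.mulVec ψ j) * star (U.1.mulVec ψ k * U.1.mulVec ψ l) ∂μ

theorem haarMoment_def (i j k l : Fin d) :
    haarMoment μ ψ i j k l = ∫ U : Matrix.unitaryGroup (Fin d) ℂ,
      (U.1.mulVec ψ i * U.1.mulVec ψ j) * star (U.1.mulVec ψ k * U.1.mulVec ψ l) ∂μ := rfl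

instance : BorelSpace (Matrix (Fin d) (Fin d) ℂ) := ⟨rfl⟩

instance : SecondCountableTopology (Matrix (Fin d) (Fin d) ℂ) :=
  inferInstanceAs (SecondCountableTopology (Fin d → Fin d → ℂ))

theorem integral_unitary_mulVec [μ.IsMulLeftInvariant] (g : (Fin d → ℂ) → ℂ)
    (V : Matrix.unitaryGroup (Fin d) ℂ) :
    ∫ U : Matrix.unitaryGroup (Fin d) ℂ, g (V.1.mulVec (U.1.mulVec ψ)) ∂μ
      = ∫ U : Matrix.unitaryGroup (Fin d) ℂ, g (U.1.mulVec ψ) ∂μ := by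
  simpa [Matrix.mulVec_mulVec] using
    integral_mul_left_eq_self (μ := μ) (fun U => g (U.1.mulVec ψ)) V

theorem continuous_unitary_mulVec (i : Fin d) :
    Continuous fun U : Matrix.unitaryGroup (Fin d) ℂ => U.1.mulVec ψ i :=
  (continuous_apply i).comp (continuous_subtype_val.matrix_mulVec continuous_const)

theorem norm_unitary_mulVec_le (U : Matrix.unitaryGroup (Fin d) ℂ) (i : Fin d) :
    ‖U.1.mulVec ψ i‖ ≤ ∑ j, ‖ψ j‖ := by
  refine (norm_sum_le Finset.univ fun j => U.1 i j * ψ j).trans (Finset.sum_le_sum fun j _ => ?_)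
  rw [norm_mul]
  exact mul_le_of_le_one_left (norm_nonneg _) (entry_norm_bound_of_unitary U.2 i j)

theorem integrable_haarMoment [IsFiniteMeasure μ] (i j k l : Fin d) :
    Integrable (fun U : Matrix.unitaryGroup (Fin d) ℂ =>
      (U.1.mulVec ψ i * U.1.mulVec ψ j) * star (U.1.mulVec ψ k * U.1.mulVec ψ l)) μ := by
  have h := continuous_unitary_mulVec ψ
  have hb := norm_unitary_mulVec_le ψ
  refine Integrable.of_bound
    (((h i).mul (h j)).mul ((h k).mul (h l)).star).aestronglyMeasurable
    (((∑ j, ‖ψ j‖) * ∑ j, ‖ψ j‖) * ((∑ j, ‖ψ j‖) * ∑ j, ‖ψ j‖))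
    (Filter.Eventually.of_forall fun U => ?_)
  rw [norm_mul, norm_star, norm_mul, norm_mul]
  gcongr <;> exact hb U _

theorem sum_mul_star_unitary_mulVec (hψ : ∑ i, ‖ψ i‖ ^ 2 = 1)
    (U : Matrix.unitaryGroup (Fin d) ℂ) :
    ∑ i, U.1.mulVec ψ i * star (U.1.mulVec ψ i) = 1 := by
  have hU : U.1.conjTranspose * U.1 = 1 := Matrix.mem_unitaryGroup_iff'.mp U.2
  have hone : ψ ⬝ᵥ star ψ = 1 := by
    rw [← Complex.ofReal_one, ← hψ]
    simp [dotProduct, Complex.mul_conj, Complex.normSq_eq_norm_sq]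
  change U.1.mulVec ψ ⬝ᵥ star (U.1.mulVec ψ) = 1
  rw [dotProduct_comm, Matrix.star_mulVec, ← Matrix.dotProduct_mulVec, Matrix.mulVec_mulVec, hU,
    Matrix.one_mulVec, dotProduct_comm, hone]

theorem sum_haarMoment [IsProbabilityMeasure μ] (hψ : ∑ i, ‖ψ i‖ ^ 2 = 1) :
    ∑ i, ∑ j, haarMoment μ ψ i j i j = 1 := by
  have hint := integrable_haarMoment μ ψ
  have hx : ∀ U : Matrix.unitaryGroup (Fin d) ℂ, ∑ i, ∑ j,
      (U.1.mulVec ψ i * U.1.mulVec ψ j) * star (U.1.mulVec ψ i * U.1.mulVec ψ j) = 1 := by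
    intro U
    rw [← one_mul (1 : ℂ), ← sum_mul_star_unitary_mulVec ψ hψ U, Finset.sum_mul_sum]
    refine Finset.sum_congr rfl fun i _ => Finset.sum_congr rfl fun j _ => ?_
    rw [star_mul']
    ring
  simp only [haarMoment]
  simp_rw [← integral_finsetSum _ fun j _ => hint _ j _ j]
  rw [← integral_finsetSum _ fun i _ => integrable_finsetSum _ fun j _ => hint i j i j]
  simp only [hx]
  simp

theorem haarMoment_comm_left (i j k l : Fin d) :
    haarMoment μ ψ i j k l = haarMoment μ ψ j i k l := by
  simp only [haarMoment, mul_comm (Matrix.mulVec _ ψ i)]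

theorem haarMoment_comm_right (i j k l : Fin d) :
    haarMoment μ ψ i j k l = haarMoment μ ψ i j l k := by
  simp only [haarMoment, mul_comm (Matrix.mulVec _ ψ k)]

variable [μ.IsMulLeftInvariant]

/-- Multiplying one coordinate by `Complex.I` is unitary. -/
theorem haarMoment_eq_phase_mul (a i j k l : Fin d) :
    haarMoment μ ψ i j k l =
      ((if i = a then Complex.I else 1) * (if j = a then Complex.I else 1) *
        star ((if k = a then Complex.I else 1) * (if l = a then Complex.I else 1))) *
        haarMoment μ ψ i j k l := by
  obtain ⟨V, hV⟩ := Matrix.exists_unitaryGroup_mulVec_eq (c := Complex.I - 1)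
    (w := Pi.single a 1) (by apply Complex.ext <;> simp)
  have hVx : ∀ (x : Fin d → ℂ) (t : Fin d),
      V.1.mulVec x t = (if t = a then Complex.I else 1) * x t := by
    intro x t
    rw [hV]
    by_cases h : t = a
    · subst h
      simp
      ring
    · simp [h]
  rw [haarMoment, ← integral_const_mul,
    ← integral_unitary_mulVec μ ψ (fun x => x i * x j * star (x k * x l)) V]
  refine integral_congr_ae (Filter.Eventually.of_forall fun U => ?_)
  simp only [hVx, star_mul']
  ring

theorem haarMoment_eq_zero {i j k l : Fin d} (h : ¬((i = k ∧ j = l) ∨ (i = l ∧ j = k))) :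
    haarMoment μ ψ i j k l = 0 := by
  have hi := haarMoment_eq_phase_mul μ ψ i i j k l
  have hj := haarMoment_eq_phase_mul μ ψ j i j k l
  by_contra hne
  have cancel : ∀ z : ℂ, haarMoment μ ψ i j k l = z * haarMoment μ ψ i j k l → z = 1 :=
    fun z hz => mul_right_cancel₀ hne (by rw [one_mul]; exact hz.symm)
  replace hi := cancel _ hi
  replace hj := cancel _ hj
  split_ifs at hi hj <;> first
    | grind
    | (norm_num [Complex.ext_iff] at hi; done)
    | norm_num [Complex.ext_iff] at hj

theorem haarMoment_diag_add_diag [IsFiniteMeasure μ] {a b : Fin d} (hab : a ≠ b) :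
    haarMoment μ ψ a a a a = haarMoment μ ψ a b a b +
      (haarMoment μ ψ a a a a + haarMoment μ ψ b b b b) / 4 := by
  obtain ⟨V, hV⟩ := Matrix.exists_unitaryGroup_mulVec_eq (c := (Complex.I - 1) / 2)
    (w := Pi.single a 1 + Pi.single b 1)
    (by apply Complex.ext <;> simp [hab, hab.symm] <;> norm_num)
  have hVx : ∀ x : Fin d → ℂ, V.1.mulVec x a * V.1.mulVec x a =
      Complex.I / 2 * (x a * x a) - x a * x b - Complex.I / 2 * (x b * x b) := by
    intro x
    rw [hV]
    simp [hab]
    ring_nf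
    simp
    ring
  have hexp : ∀ x : Fin d → ℂ,
      (V.1.mulVec x a * V.1.mulVec x a) * star (V.1.mulVec x a * V.1.mulVec x a) =
        1 / 4 * ((x a * x a) * star (x a * x a)) + 1 * ((x a * x b) * star (x a * x b))
        + 1 / 4 * ((x b * x b) * star (x b * x b))
        + (-1 / 4) * ((x a * x a) * star (x b * x b))
        + (-1 / 4) * ((x b * x b) * star (x a * x a))
        + (-Complex.I / 2) * ((x a * x a) * star (x a * x b))
        + (Complex.I / 2) * ((x b * x b) * star (x a * x b))
        + (Complex.I / 2) * ((x a * x b) * star (x a * x a))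
        + (-Complex.I / 2) * ((x a * x b) * star (x b * x b)) := by
    intro x
    rw [hVx]
    simp only [star_sub, star_mul', Complex.star_def, map_div₀, Complex.conj_I, map_ofNat]
    ring_nf
    simp only [Complex.I_sq]
    ring
  have hint := fun (c : ℂ) i j k l => (integrable_haarMoment μ ψ i j k l).const_mul c
  conv_lhs => rw [haarMoment, ← integral_unitary_mulVec μ ψ
    (fun x => (x a * x a) * star (x a * x a)) V]
  simp only [hexp]
  repeat rw [integral_add (by fun_prop (disch := assumption)) (hint _ _ _ _ _)]
  simp only [integral_const_mul, ← haarMoment_def]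
  rw [haarMoment_eq_zero μ ψ (i := a) (j := a) (k := b) (l := b) (by grind),
    haarMoment_eq_zero μ ψ (i := b) (j := b) (k := a) (l := a) (by grind),
    haarMoment_eq_zero μ ψ (i := a) (j := a) (k := a) (l := b) (by grind),
    haarMoment_eq_zero μ ψ (i := b) (j := b) (k := a) (l := b) (by grind),
    haarMoment_eq_zero μ ψ (i := a) (j := b) (k := a) (l := a) (by grind),
    haarMoment_eq_zero μ ψ (i := a) (j := b) (k := b) (l := b) (by grind)]
  ring

theorem haarMoment_offDiag [IsFiniteMeasure μ] {a b : Fin d} (hab : a ≠ b) :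
    haarMoment μ ψ a a a a = 2 * haarMoment μ ψ a b a b := by
  have h₁ := haarMoment_diag_add_diag μ ψ hab
  have h₂ := haarMoment_diag_add_diag μ ψ hab.symm
  rw [haarMoment_comm_left μ ψ b a, haarMoment_comm_right μ ψ a b b a] at h₂
  linear_combination (3 / 2) * h₁ + (1 / 2) * h₂

theorem haarMoment_diag_eq [IsFiniteMeasure μ] (a b : Fin d) :
    haarMoment μ ψ a a a a = haarMoment μ ψ b b b b := by
  rcases eq_or_ne a b with rfl | hab
  · rfl
  · rw [haarMoment_offDiag μ ψ hab, haarMoment_offDiag μ ψ hab.symm, haarMoment_comm_left,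
      haarMoment_comm_right]

theorem haarMoment_diag [IsProbabilityMeasure μ] (hψ : ∑ i, ‖ψ i‖ ^ 2 = 1) (a : Fin d) :
    haarMoment μ ψ a a a a = 2 / ((d : ℂ) * ((d : ℂ) + 1)) := by
  obtain ⟨A, hA⟩ : ∃ A, A = haarMoment μ ψ a a a a := ⟨_, rfl⟩
  rw [← hA]
  have hterm : ∀ i j, haarMoment μ ψ i j i j =
      A / 2 * (1 + if i = j then 1 else 0) := by
    intro i j
    rw [hA, haarMoment_diag_eq μ ψ a i]
    split_ifs with h
    · subst h
      ring
    · rw [haarMoment_offDiag μ ψ h]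
      ring
  have hsum := sum_haarMoment μ ψ hψ
  simp_rw [hterm, ← Finset.mul_sum, Finset.sum_add_distrib] at hsum
  simp at hsum
  have hd : (d : ℂ) ≠ 0 := Nat.cast_ne_zero.mpr a.pos.ne'
  have hd' : (d : ℂ) + 1 ≠ 0 := Nat.cast_add_one_ne_zero d
  field_simp
  linear_combination 2 * hsum

end HaarMoments

/-- Averaging `(UρU†) ⊗ (UρU†)` over the Haar probability measure on `U(d)`, for a rank-one
projection `ρ = ψψ†` onto a unit vector, gives `(2/(d(d+1))) P_sym` (entrywise). -/
theorem haar_average_two_copies {d : ℕ} (hd : 0 < d)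
    (μ : Measure (Matrix.unitaryGroup (Fin d) ℂ))
    [μ.IsHaarMeasure] [IsProbabilityMeasure μ]
    (ψ : Fin d → ℂ) (hψ : ∑ i, ‖ψ i‖ ^ 2 = 1)
    (p q : Fin d × Fin d) :
    ∫ U : Matrix.unitaryGroup (Fin d) ℂ,
        (((U : Matrix (Fin d) (Fin d) ℂ) * Matrix.vecMulVec ψ (star ψ)
            * star (U : Matrix (Fin d) (Fin d) ℂ)) ⊗ₖ
         ((U : Matrix (Fin d) (Fin d) ℂ) * Matrix.vecMulVec ψ (star ψ)
            * star (U : Matrix (Fin d) (Fin d) ℂ))) p q ∂μ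
      = (2 / ((d : ℂ) * ((d : ℂ) + 1))) * symProj d p q := by
  obtain ⟨i, j⟩ := p
  obtain ⟨k, l⟩ := q
  have hmoment : ∀ U : Matrix.unitaryGroup (Fin d) ℂ,
      (((U : Matrix (Fin d) (Fin d) ℂ) * Matrix.vecMulVec ψ (star ψ)
            * star (U : Matrix (Fin d) (Fin d) ℂ)) ⊗ₖ
         ((U : Matrix (Fin d) (Fin d) ℂ) * Matrix.vecMulVec ψ (star ψ)
            * star (U : Matrix (Fin d) (Fin d) ℂ))) (i, j) (k, l) =
        (U.1.mulVec ψ i * U.1.mulVec ψ j) * star (U.1.mulVec ψ k * U.1.mulVec ψ l) := by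
    intro U
    rw [Matrix.mul_vecMulVec, Matrix.vecMulVec_mul, Matrix.star_eq_conjTranspose,
      ← Matrix.star_mulVec, Matrix.kroneckerMap_apply, Matrix.vecMulVec_apply,
      Matrix.vecMulVec_apply, star_mul', Pi.star_apply, Pi.star_apply]
    ring
  simp only [hmoment]
  rw [← haarMoment]
  by_cases h : (i = k ∧ j = l) ∨ (i = l ∧ j = k)
  · rw [← haarMoment_diag μ ψ hψ i]
    by_cases hij : i = j
    · obtain ⟨rfl, rfl, rfl⟩ : i = j ∧ i = k ∧ i = l := by grind
      simp [symProj, swapMatrix]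
      ring
    · rw [haarMoment_offDiag μ ψ hij]
      rcases h with ⟨rfl, rfl⟩ | ⟨rfl, rfl⟩
      · simp [symProj, swapMatrix, hij]
        ring
      · rw [haarMoment_comm_right]
        simp [symProj, swapMatrix, hij]
        ring
  · rw [haarMoment_eq_zero μ ψ h]
    rw [not_or] at h
    simp [symProj, swapMatrix, h.1, h.2]
end

section
/- Let 0 ≤ p ≤ 1 and d ≥ 1, and let P_sym = (1/2)(I + S) be the projector onto the symmetric subspace of ℂ^d ⊗ ℂ^d. Let Tr₁, Tr₂ denote the partial traces on d²×d² matrices indexed by pairs, i.e., (Tr₂ M)_{i,j} = Σ_k M_{(i,k),(j,k)} and (Tr₁ M)_{i,j} = Σ_k M_{(k,i),(k,j)}. Define the two-fold depolarizing map applied to P_sym as T = p²·P_sym + p(1−p)·( Tr₂(P_sym) ⊗ (I/d) + (I/d) ⊗ Tr₁(P_sym) ) + (1−p)²·Tr(P_sym)·I/d², where ⊗ is the Kronecker product. Then T = p²·P_sym + (1−p²)·((d+1)/(2d))·I, and the ℓ²→ℓ² operator norm of T equals (d+1)/(2d) + p²·(1 − (d+1)/(2d)). -/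
open Kronecker

/-- The partial trace over the second tensor factor:
`(Tr₂ M)_{i,j} = Σ_k M_{(i,k),(j,k)}`. -/
noncomputable def ptrace2 {d : ℕ} (M : Matrix (Fin d × Fin d) (Fin d × Fin d) ℂ) :
    Matrix (Fin d) (Fin d) ℂ :=
  fun i j => ∑ k, M (i, k) (j, k)

/-- The partial trace over the first tensor factor:
`(Tr₁ M)_{i,j} = Σ_k M_{(k,i),(k,j)}`. -/
noncomputable def ptrace1 {d : ℕ} (M : Matrix (Fin d × Fin d) (Fin d × Fin d) ℂ) :
    Matrix (Fin d) (Fin d) ℂ :=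
  fun i j => ∑ k, M (k, i) (k, j)

/-- The result `T` of applying the two-fold depolarizing channel to `P_sym`. -/
noncomputable def depolSym (d : ℕ) (p : ℝ) : Matrix (Fin d × Fin d) (Fin d × Fin d) ℂ :=
  ((p : ℂ) ^ 2) • symProj d
    + ((p : ℂ) * ((1 - p : ℝ) : ℂ)) •
        (ptrace2 (symProj d) ⊗ₖ (((d : ℂ))⁻¹ • (1 : Matrix (Fin d) (Fin d) ℂ))
          + (((d : ℂ))⁻¹ • (1 : Matrix (Fin d) (Fin d) ℂ)) ⊗ₖ ptrace1 (symProj d))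
    + ((((1 - p : ℝ) : ℂ)) ^ 2 * (symProj d).trace / ((d : ℂ) ^ 2)) •
        (1 : Matrix (Fin d × Fin d) (Fin d × Fin d) ℂ)

theorem swapMatrix_mul_self (d : ℕ) : swapMatrix d * swapMatrix d = 1 := by
  ext ⟨i, j⟩ ⟨k, l⟩
  simp [Matrix.mul_apply, swapMatrix, Fintype.sum_prod_type, ite_and, Matrix.one_apply]

theorem swapMatrix_conjTranspose (d : ℕ) : (swapMatrix d).conjTranspose = swapMatrix d := by
  ext ⟨i, j⟩ ⟨k, l⟩
  simp only [Matrix.conjTranspose_apply, swapMatrix, apply_ite star, star_one, star_zero]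
  grind

theorem isStarProjection_symProj (d : ℕ) : IsStarProjection (symProj d) where
  isIdempotentElem := by
    simp only [IsIdempotentElem, symProj, smul_mul_smul_comm, mul_add, add_mul,
      swapMatrix_mul_self, mul_one, one_mul]
    module
  isSelfAdjoint := by
    simp [IsSelfAdjoint, symProj, Matrix.star_eq_conjTranspose, swapMatrix_conjTranspose]

theorem ptrace2_symProj (d : ℕ) :
    ptrace2 (symProj d) = (((d : ℂ) + 1) / 2) • (1 : Matrix (Fin d) (Fin d) ℂ) := by
  ext i j
  rcases eq_or_ne i j with rfl | h
  · simp [ptrace2, symProj, swapMatrix, ← Finset.mul_sum, Finset.sum_add_distrib, ite_and]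
    ring
  · simp [ptrace2, symProj, swapMatrix, ite_and, h]

theorem ptrace1_symProj (d : ℕ) :
    ptrace1 (symProj d) = (((d : ℂ) + 1) / 2) • (1 : Matrix (Fin d) (Fin d) ℂ) := by
  ext i j
  rcases eq_or_ne i j with rfl | h
  · simp [ptrace1, symProj, swapMatrix, ← Finset.mul_sum, Finset.sum_add_distrib, ite_and]
    ring
  · simp [ptrace1, symProj, swapMatrix, ite_and, h]

theorem trace_symProj (d : ℕ) : (symProj d).trace = (d : ℂ) * (d + 1) / 2 := by
  have h : (symProj d).trace = (ptrace2 (symProj d)).trace := by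
    simp [Matrix.trace, ptrace2, Fintype.sum_prod_type]
  rw [h, ptrace2_symProj, Matrix.trace_smul, Matrix.trace_one, Fintype.card_fin, smul_eq_mul]
  ring

theorem depolSym_eq (d : ℕ) (hd : 1 ≤ d) (p : ℝ) :
    depolSym d p
      = ((p : ℂ) ^ 2) • symProj d
        + ((1 - (p : ℂ) ^ 2) * (((d : ℂ) + 1) / (2 * (d : ℂ)))) •
            (1 : Matrix (Fin d × Fin d) (Fin d × Fin d) ℂ) := by
  have hd0 : (d : ℂ) ≠ 0 := by exact_mod_cast (by omega : d ≠ 0)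
  simp only [depolSym, ptrace2_symProj, ptrace1_symProj, trace_symProj, Matrix.smul_kronecker,
    Matrix.kronecker_smul, Matrix.one_kronecker_one, add_assoc, smul_smul, ← add_smul]
  congr 2
  push_cast
  field_simp
  ring

theorem symProj_mulVec_single (d : ℕ) (i : Fin d) :
    (symProj d).mulVec (Pi.single (i, i) 1) = Pi.single (i, i) 1 := by
  ext ⟨k, l⟩
  simp [symProj, swapMatrix, Matrix.one_apply, Pi.single_apply]
  grind

theorem norm_toEuclideanCLM_smul_symProj_add_smul_one (d : ℕ) (hd : 1 ≤ d) {a b : ℝ}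
    (ha : 0 ≤ a) (hb : 0 ≤ b) :
    ‖Matrix.toEuclideanCLM (𝕜 := ℂ) (n := Fin d × Fin d)
      ((a : ℂ) • symProj d + (b : ℂ) • (1 : Matrix (Fin d × Fin d) (Fin d × Fin d) ℂ))‖
      = a + b := by
  have hP : ‖Matrix.toEuclideanCLM (𝕜 := ℂ) (n := Fin d × Fin d) (symProj d)‖ ≤ 1 :=
    ((isStarProjection_symProj d).map (Matrix.toEuclideanCLM (𝕜 := ℂ))).norm_le
  apply le_antisymm
  · rw [map_add, map_smul, map_smul, map_one]
    refine (norm_add_le _ _).trans (add_le_add ?_ ?_)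
    · rw [norm_smul, Complex.norm_of_nonneg ha]
      exact mul_le_of_le_one_right ha hP
    · rw [norm_smul, Complex.norm_of_nonneg hb]
      exact mul_le_of_le_one_right hb ContinuousLinearMap.norm_id_le
  · let v : EuclideanSpace ℂ (Fin d × Fin d) := EuclideanSpace.single (⟨0, hd⟩, ⟨0, hd⟩) 1
    have hv : ‖v‖ = 1 := by simp [v]
    set T := Matrix.toEuclideanCLM (𝕜 := ℂ) (n := Fin d × Fin d)
      ((a : ℂ) • symProj d + (b : ℂ) • (1 : Matrix (Fin d × Fin d) (Fin d × Fin d) ℂ)) with hT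
    have hTv : T v = ((a + b : ℝ) : ℂ) • v := by
      apply (WithLp.ofLp_injective 2)
      rw [hT, Matrix.ofLp_toEuclideanCLM]
      rw [WithLp.ofLp_smul, PiLp.ofLp_single, Matrix.add_mulVec, Matrix.smul_mulVec,
        Matrix.smul_mulVec, symProj_mulVec_single, Matrix.one_mulVec, ← add_smul,
        Complex.ofReal_add]
    have h := T.le_opNorm v
    rwa [hTv, norm_smul, hv, mul_one, mul_one, Complex.norm_of_nonneg (add_nonneg ha hb)] at h

/-- Applying the tensor square of the depolarizing channel to `P_sym` gives
`p² P_sym + (1-p²)((d+1)/(2d)) I`, whose `ℓ²→ℓ²` operator norm equals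
`(d+1)/(2d) + p² (1 - (d+1)/(2d))`. -/
theorem depolSym_eq_and_opNorm (d : ℕ) (hd : 1 ≤ d) (p : ℝ) (hp0 : 0 ≤ p) (hp1 : p ≤ 1) :
    depolSym d p
      = ((p : ℂ) ^ 2) • symProj d
        + ((1 - (p : ℂ) ^ 2) * (((d : ℂ) + 1) / (2 * (d : ℂ)))) •
            (1 : Matrix (Fin d × Fin d) (Fin d × Fin d) ℂ) ∧
    ‖(Matrix.toEuclideanCLM (𝕜 := ℂ) (n := Fin d × Fin d) (depolSym d p) :
        EuclideanSpace ℂ (Fin d × Fin d) →L[ℂ] EuclideanSpace ℂ (Fin d × Fin d))‖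
      = ((d : ℝ) + 1) / (2 * d) + p ^ 2 * (1 - ((d : ℝ) + 1) / (2 * d)) := by
  refine ⟨depolSym_eq d hd p, ?_⟩
  have hb : 0 ≤ (1 - p ^ 2) * (((d : ℝ) + 1) / (2 * d)) :=
    mul_nonneg (sub_nonneg.2 (pow_le_one₀ hp0 hp1)) (by positivity)
  have h := norm_toEuclideanCLM_smul_symProj_add_smul_one d hd (sq_nonneg p) hb
  push_cast at h
  rw [depolSym_eq d hd p, h]
  ring
end
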